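/- Let θ ∈ ℝⁿ with |θ| = 1, let x ∈ ℝⁿ with θ·x = 0, let r ∈ (0,1), and let s ≥ μ satisfy s > 2^{3/2} r and 4βn(|x|+1)(1 + 1/(2^{−3/2}s − r))² ≤ α r (2^{−3/2}s − r)(1−r)^{α+2}. Let y_− be the unique fixed point of A (with v_− = sθ, x_− = x) in M_r, let a := sθ + ∫_{−∞}^∞ F(z_−(sθ,τ)+x+y_−(τ)) dτ, and define b_sc(sθ,x) := l + l₁ + l₂ and W(sθ,x) := ∫_{−∞}^0 ∫_{−∞}^σ (F^l(z_−(sθ,τ)+x) − F^l(z_−(sθ,τ))) dτ dσ − ∫_0^∞ ∫_σ^∞ (F^l(z_+(a,τ)+x) − F^l(z_+(a,τ))) dτ dσ. Then |b_sc(sθ,x) − W(sθ,x) − ∫_{−∞}^0 ∫_{−∞}^σ F^s(τ sθ + x) dτ dσ + ∫_0^∞ ∫_σ^∞ F^s(τ sθ + x) dτ dσ| ≤ 4n²(3|x|+5)β²(1 + 1/(2^{−3/2}s − r))² / (α²(1−r)^{2α+2}(2^{−3/2}s − r)³). -/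

import Mathlib

open MeasureTheory Real Filter Set Topology RealInnerProductSpace

noncomputable section

namespace Paper

/-- ℝⁿ -/
abbrev Euc (n : ℕ) : Type := EuclideanSpace ℝ (Fin n)

variable {n : ℕ}

/-- the norm `sup_{t ≤ 0} ‖f t‖ + sup_{t ≥ 0} ‖f t‖/(1+t)` on the space `M_r`. -/
def Mnorm (f : ℝ → Euc n) : ℝ :=
  sSup ((fun t => ‖f t‖) '' Iic 0) + sSup ((fun t => ‖f t‖ / (1 + t)) '' Ici 0)

/-- membership in the complete metric space `M_r`. -/
def MemM (r : ℝ) (f : ℝ → Euc n) : Prop :=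
  Continuous f ∧ BddAbove ((fun t => ‖f t‖) '' Iic 0) ∧
    BddAbove ((fun t => ‖f t‖ / (1 + t)) '' Ici 0) ∧ Mnorm f ≤ r

/-- the long range decay conditions on `V^l`. -/
def LongRange (α βl0 βl1 βl2 : ℝ) (Vl : Euc n → ℝ) : Prop :=
  ContDiff ℝ 2 Vl ∧
    (∀ x, |Vl x| ≤ βl0 * (1 + ‖x‖) ^ (-α)) ∧
    (∀ x, ‖gradient Vl x‖ ≤ βl1 * (1 + ‖x‖) ^ (-(α + 1))) ∧
    (∀ x, ‖iteratedFDeriv ℝ 2 Vl x‖ ≤ βl2 * (1 + ‖x‖) ^ (-(α + 2)))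

/-- the short range decay conditions on `V^s`. -/
def ShortRange (α βs1 βs2 βs3 : ℝ) (Vs : Euc n → ℝ) : Prop :=
  ContDiff ℝ 2 Vs ∧
    (∀ x, |Vs x| ≤ βs1 * (1 + ‖x‖) ^ (-(α + 1))) ∧
    (∀ x, ‖gradient Vs x‖ ≤ βs2 * (1 + ‖x‖) ^ (-(α + 2))) ∧
    (∀ x, ‖iteratedFDeriv ℝ 2 Vs x‖ ≤ βs3 * (1 + ‖x‖) ^ (-(α + 3)))

/-- `z` is a C² solution of `z'' = Fl ∘ z` with `z 0 = x0`, `z' → w` along the filter `l`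
(`atBot` for `z_-`, `atTop` for `z_+`), satisfying the growth bound `‖z t - x0 - t w‖ ≤ C |t|`. -/
def IsFreeSol (Fl : Euc n → Euc n) (x0 w : Euc n) (l : Filter ℝ) (C : ℝ)
    (z : ℝ → Euc n) : Prop :=
  ContDiff ℝ 2 z ∧ (∀ t, deriv (deriv z) t = Fl (z t)) ∧ z 0 = x0 ∧
    Tendsto (fun t => deriv z t) l (𝓝 w) ∧ ∀ t, ‖z t - x0 - t • w‖ ≤ C * |t|

/-- the map `A` (or `𝒜` when `xm = 0` and `zm` already contains the base point). -/
def Aop (Fl F : Euc n → Euc n) (zm : ℝ → Euc n) (xm : Euc n)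
    (f : ℝ → Euc n) (t : ℝ) : Euc n :=
  ∫ σ in Iic t, ∫ τ in Iic σ, (F (zm τ + xm + f τ) - Fl (zm τ))

/-- the vector `l(v_-,x_-,y_-)`. -/
def lInt (Fl Fs F : Euc n → Euc n) (zm : ℝ → Euc n) (xm : Euc n) (ym : ℝ → Euc n) : Euc n :=
  (∫ σ in Iic (0:ℝ), ∫ τ in Iic σ, (F (zm τ + xm + ym τ) - Fl (zm τ))) -
    ∫ σ in Ici (0:ℝ), ∫ τ in Ici σ, Fs (zm τ + xm + ym τ)

/-- the vector `l₁(v_-,x_-)`. -/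
def l1Int (Fl : Euc n → Euc n) (zp : ℝ → Euc n) (xm : Euc n) : Euc n :=
  -∫ σ in Ici (0:ℝ), ∫ τ in Ici σ, (Fl (zp τ + xm) - Fl (zp τ))

/-- the vector `l₂(v_-,x_-,y_-)`. -/
def l2Int (Fl : Euc n → Euc n) (zm zp : ℝ → Euc n) (xm : Euc n) (ym : ℝ → Euc n) : Euc n :=
  -∫ σ in Ici (0:ℝ), ∫ τ in Ici σ, (Fl (zm τ + xm + ym τ) - Fl (zp τ + xm))

/-- the function `y_+`. -/
def yplusInt (Fl F : Euc n → Euc n) (zm zp : ℝ → Euc n) (xm : Euc n) (ym : ℝ → Euc n)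
    (t : ℝ) : Euc n :=
  ∫ σ in Ici t, ∫ τ in Ici σ, (F (zm τ + xm + ym τ) - Fl (zp τ))

/-- the vector `W(v_-,x_-)`. -/
def Wvec (Fl : Euc n → Euc n) (zm zp : ℝ → Euc n) (xm : Euc n) : Euc n :=
  (∫ σ in Iic (0:ℝ), ∫ τ in Iic σ, (Fl (zm τ + xm) - Fl (zm τ))) -
    ∫ σ in Ici (0:ℝ), ∫ τ in Ici σ, (Fl (zp τ + xm) - Fl (zp τ))

/-- the map `𝒢_{v_-,x_-}`; here `zm = z_-(v_-,x_-,·)` contains the base point `x_-`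
and `zp h = z_+(ã, x_- + h, ·)`. -/
def Gmap (Fl Fs F : Euc n → Euc n) (zm : ℝ → Euc n) (zp : Euc n → ℝ → Euc n)
    (ym : ℝ → Euc n) (h : Euc n) : Euc n :=
  lInt Fl Fs F zm 0 ym -
    ∫ σ in Ici (0:ℝ), ∫ τ in Ici σ, (Fl (zm τ + ym τ) - Fl (zp h τ))

/-- the vector `W̃(v_-,x_-)`; here `zp0 = z_+(ã, x_-, ·)`. -/
def Wtilde (Fl : Euc n → Euc n) (zm zp0 : ℝ → Euc n) : Euc n :=
  (∫ τ in Iic (0:ℝ), Fl (zm τ)) + ∫ τ in Ici (0:ℝ), Fl (zp0 τ)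

/-! ### Integrals of decaying functions -/

lemma integral_affine_rpow {c w p T : ℝ} (hc : 0 < c) (hw : 0 < w) (hp : 0 < p) (hT : 0 ≤ T) :
    IntegrableOn (fun τ : ℝ => (c + w * τ) ^ (-(p + 1))) (Ici T) ∧
      ∫ τ in Ici T, (c + w * τ) ^ (-(p + 1)) = (c + w * T) ^ (-p) / (p * w) := by
  have hpos : ∀ τ ∈ Ici T, 0 < c + w * τ := fun τ hτ => by
    have : 0 ≤ w * τ := mul_nonneg hw.le (hT.trans hτ)
    linarith
  have hder : ∀ τ ∈ Ici T, HasDerivAt (fun τ : ℝ => -((c + w * τ) ^ (-p) / (p * w)))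
      ((c + w * τ) ^ (-(p + 1))) τ := by
    intro τ hτ
    have h1 : HasDerivAt (fun τ : ℝ => c + w * τ) w τ := by
      simpa using ((hasDerivAt_id τ).const_mul w).const_add c
    have h2 := ((h1.rpow_const (p := -p) (Or.inl (hpos τ hτ).ne')).div_const (p * w)).fun_neg
    refine h2.congr_deriv ?_
    have : -p - 1 = -(p + 1) := by ring
    rw [this]
    field_simp
  have hlim : Tendsto (fun τ : ℝ => -((c + w * τ) ^ (-p) / (p * w))) atTop (𝓝 0) := by
    have h1 : Tendsto (fun τ : ℝ => c + w * τ) atTop atTop :=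
      tendsto_atTop_add_const_left _ _ (tendsto_id.const_mul_atTop hw)
    have h2 := ((tendsto_rpow_neg_atTop hp).comp h1).div_const (p * w)
    simpa using h2.neg
  have hnn : ∀ τ ∈ Ioi T, 0 ≤ (c + w * τ) ^ (-(p + 1)) := fun τ hτ =>
    rpow_nonneg (hpos τ (mem_Ici_of_Ioi hτ)).le _
  constructor
  · rw [integrableOn_Ici_iff_integrableOn_Ioi]
    exact integrableOn_Ioi_deriv_of_nonneg' hder hnn hlim
  · rw [integral_Ici_eq_integral_Ioi,
      integral_Ioi_of_hasDerivAt_of_tendsto' hder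
        (integrableOn_Ioi_deriv_of_nonneg' hder hnn hlim) hlim]
    ring

/-- continuous functions on the line which are `O((c + w τ)^{-(α+2)})` at `+∞`. -/
def TailDecay (α c w M : ℝ) (g : ℝ → Euc n) : Prop :=
  Continuous g ∧ ∀ τ, 0 ≤ τ → ‖g τ‖ ≤ M * (c + w * τ) ^ (-(α + 2))

section Tail

variable {α c w M M' : ℝ} {g g' : ℝ → Euc n}

lemma TailDecay.add (h : TailDecay α c w M g) (h' : TailDecay α c w M' g') :
    TailDecay α c w (M + M') (fun τ => g τ + g' τ) :=
  ⟨h.1.add h'.1, fun τ hτ => (norm_add_le _ _).trans (by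
    rw [add_mul]; exact add_le_add (h.2 τ hτ) (h'.2 τ hτ))⟩

lemma TailDecay.sub (h : TailDecay α c w M g) (h' : TailDecay α c w M' g') :
    TailDecay α c w (M + M') (fun τ => g τ - g' τ) :=
  ⟨h.1.sub h'.1, fun τ hτ => (norm_sub_le _ _).trans (by
    rw [add_mul]; exact add_le_add (h.2 τ hτ) (h'.2 τ hτ))⟩

variable (hα : 0 < α) (hc : 0 < c) (hw : 0 < w)

include hα hc hw in
lemma TailDecay.integrableOn (h : TailDecay α c w M g) {σ : ℝ} (hσ : 0 ≤ σ) :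
    IntegrableOn g (Ici σ) := by
  have h1 := (integral_affine_rpow (p := α + 1) hc hw (by linarith) hσ).1.const_mul M
  refine Integrable.mono' h1 h.1.aestronglyMeasurable ?_
  filter_upwards [ae_restrict_mem measurableSet_Ici] with τ hτ
  refine (h.2 τ (hσ.trans hτ)).trans_eq ?_
  congr 2; ring

include hα hc hw in
lemma TailDecay.norm_integral_le (hM : 0 ≤ M) (h : TailDecay α c w M g) {σ : ℝ} (hσ : 0 ≤ σ) :
    ‖∫ τ in Ici σ, g τ‖ ≤ M / w * (c + w * σ) ^ (-(α + 1)) := by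
  have h1 := integral_affine_rpow (p := α + 1) hc hw (by linarith) hσ
  have h2 : ‖∫ τ in Ici σ, g τ‖ ≤ ∫ τ in Ici σ, M * (c + w * τ) ^ (-(α + 1 + 1)) := by
    refine norm_integral_le_of_norm_le (h1.1.const_mul M) ?_
    filter_upwards [ae_restrict_mem measurableSet_Ici] with τ hτ
    refine (h.2 τ (hσ.trans hτ)).trans_eq ?_
    congr 2; ring
  refine h2.trans ?_
  rw [integral_const_mul, h1.2]
  have h3 : 0 ≤ (c + w * σ) ^ (-(α + 1)) := by positivity
  have h4 : (c + w * σ) ^ (-(α + 1)) / ((α + 1) * w) ≤ (c + w * σ) ^ (-(α + 1)) / w := by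
    gcongr
    nlinarith
  calc M * ((c + w * σ) ^ (-(α + 1)) / ((α + 1) * w)) ≤ M * ((c + w * σ) ^ (-(α + 1)) / w) := by
        gcongr
    _ = _ := by ring

include hα hc hw in
lemma TailDecay.continuousOn_integral (h : TailDecay α c w M g) :
    ContinuousOn (fun σ => ∫ τ in Ici σ, g τ) (Ici 0) := by
  have h1 : ∀ σ ∈ Ici (0 : ℝ),
      ∫ τ in Ici σ, g τ = (∫ τ in Ici 0, g τ) - ∫ τ in (0 : ℝ)..σ, g τ := by
    intro σ hσ
    rw [integral_Ici_eq_integral_Ioi, integral_Ici_eq_integral_Ioi,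
      ← intervalIntegral.integral_Ioi_sub_Ioi
        ((h.integrableOn hα hc hw le_rfl).mono_set Ioi_subset_Ici_self) hσ, sub_sub_cancel]
  refine ContinuousOn.congr ?_ h1
  exact (continuous_const.sub (intervalIntegral.continuous_primitive
    (fun a b => h.1.intervalIntegrable a b) 0)).continuousOn

include hα hc hw in
lemma TailDecay.integrableOn_integral (hM : 0 ≤ M) (h : TailDecay α c w M g) {T : ℝ}
    (hT : 0 ≤ T) : IntegrableOn (fun σ => ∫ τ in Ici σ, g τ) (Ici T) := by
  refine Integrable.mono' ((integral_affine_rpow hc hw hα hT).1.const_mul (M / w))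
    (((h.continuousOn_integral hα hc hw).mono (Ici_subset_Ici.2 hT)).aestronglyMeasurable
      measurableSet_Ici) ?_
  filter_upwards [ae_restrict_mem measurableSet_Ici] with σ hσ
  exact h.norm_integral_le hα hc hw hM (hT.trans hσ)

include hα hc hw in
lemma TailDecay.norm_integral_integral_le (hM : 0 ≤ M) (h : TailDecay α c w M g) {T : ℝ}
    (hT : 0 ≤ T) : ‖∫ σ in Ici T, ∫ τ in Ici σ, g τ‖ ≤ M * (c ^ (-α) / (α * w ^ 2)) := by
  have h1 := integral_affine_rpow hc hw hα hT
  have h2 : ‖∫ σ in Ici T, ∫ τ in Ici σ, g τ‖ ≤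
      ∫ σ in Ici T, M / w * (c + w * σ) ^ (-(α + 1)) := by
    refine norm_integral_le_of_norm_le (h1.1.const_mul (M / w)) ?_
    filter_upwards [ae_restrict_mem measurableSet_Ici] with σ hσ
    exact h.norm_integral_le hα hc hw hM (hT.trans hσ)
  refine h2.trans ?_
  rw [integral_const_mul, h1.2]
  have h3 : (c + w * T) ^ (-α) ≤ c ^ (-α) :=
    rpow_le_rpow_of_nonpos hc (by nlinarith [mul_nonneg hw.le hT]) (by linarith)
  calc M / w * ((c + w * T) ^ (-α) / (α * w)) ≤ M / w * (c ^ (-α) / (α * w)) := by gcongr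
    _ = _ := by field_simp

include hα hc hw in
lemma TailDecay.integral_integral_sub (hM : 0 ≤ M) (hM' : 0 ≤ M') (h : TailDecay α c w M g)
    (h' : TailDecay α c w M' g') :
    ∫ σ in Ici (0 : ℝ), ∫ τ in Ici σ, (g τ - g' τ) =
      (∫ σ in Ici (0 : ℝ), ∫ τ in Ici σ, g τ) - ∫ σ in Ici (0 : ℝ), ∫ τ in Ici σ, g' τ := by
  rw [← integral_sub (h.integrableOn_integral hα hc hw hM le_rfl)
    (h'.integrableOn_integral hα hc hw hM' le_rfl)]
  refine setIntegral_congr_fun measurableSet_Ici fun σ hσ => ?_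
  exact integral_sub (h.integrableOn hα hc hw hσ) (h'.integrableOn hα hc hw hσ)

end Tail

lemma integral_Iic_eq_integral_Ici_neg (g : ℝ → Euc n) (t : ℝ) :
    ∫ τ in Iic t, g τ = ∫ τ in Ici (-t), g (-τ) := by
  rw [integral_Ici_eq_integral_Ioi, integral_comp_neg_Ioi, neg_neg]

lemma integral_integral_Iic_eq_Ici_neg (g : ℝ → Euc n) (t : ℝ) :
    ∫ σ in Iic t, ∫ τ in Iic σ, g τ = ∫ σ in Ici (-t), ∫ τ in Ici σ, g (-τ) := by
  rw [integral_Iic_eq_integral_Ici_neg]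
  simp only [integral_Iic_eq_integral_Ici_neg g, neg_neg]

lemma integral_abs_affine_rpow {c w p : ℝ} (hc : 0 < c) (hw : 0 < w) (hp : 0 < p) :
    Integrable (fun τ : ℝ => (c + w * |τ|) ^ (-(p + 1))) ∧
      ∫ τ : ℝ, (c + w * |τ|) ^ (-(p + 1)) = 2 * (c ^ (-p) / (p * w)) := by
  have h0 := integral_affine_rpow hc hw hp le_rfl
  constructor
  · have h1 : IntegrableOn (fun τ : ℝ => (c + w * |τ|) ^ (-(p + 1))) (Ici 0) := by
      refine h0.1.congr_fun (fun τ hτ => ?_) measurableSet_Ici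
      simp only [abs_of_nonneg (mem_Ici.1 hτ)]
    have h2 : IntegrableOn (fun τ : ℝ => (c + w * |τ|) ^ (-(p + 1))) (Iic 0) := by
      have := h1.comp_neg
      simpa using this
    rw [← integrableOn_univ, ← Iic_union_Ici (a := (0 : ℝ))]
    exact h2.union h1
  · rw [integral_comp_abs (f := fun τ => (c + w * τ) ^ (-(p + 1))),
      ← integral_Ici_eq_integral_Ioi, h0.2]
    simp

/-! ### Force fields on slabs along a free trajectory -/

/-- points whose `θ`-coordinate is close to that of the free motion `τ ↦ τ s θ + x`, `x ⊥ θ`. -/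
def slab (θ : Euc n) (s r τ : ℝ) : Set (Euc n) :=
  {p | |⟪θ, p⟫ - τ * s| ≤ s / 4 * |τ| + r * (1 + |τ|)}

lemma convex_slab (θ : Euc n) (s r τ : ℝ) : Convex ℝ (slab θ s r τ) := by
  have h : slab θ s r τ = innerSL ℝ θ ⁻¹'
      Metric.closedBall (τ * s) (s / 4 * |τ| + r * (1 + |τ|)) := by
    ext p
    simp [slab, Real.dist_eq]
  rw [h]
  exact (convex_closedBall _ _).linear_preimage (innerSL ℝ θ).toLinearMap

lemma mem_slab {θ v p : Euc n} {s r τ : ℝ} (hθ : ‖θ‖ = 1) (hv : ⟪θ, v⟫ = 0)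
    (hp : ‖p - (τ • (s • θ) + v)‖ ≤ s / 4 * |τ| + r * (1 + |τ|)) : p ∈ slab θ s r τ := by
  have h1 : ⟪θ, p⟫ - τ * s = ⟪θ, p - (τ • (s • θ) + v)⟫ := by
    rw [inner_sub_right, inner_add_right, inner_smul_right, inner_smul_right, hv,
      real_inner_self_eq_norm_sq, hθ]
    ring
  have h2 := abs_real_inner_le_norm θ (p - (τ • (s • θ) + v))
  rw [hθ, one_mul] at h2
  rw [slab, mem_ofPred_eq, h1]
  exact h2.trans hp

lemma one_add_norm_ge_of_mem_slab {θ p : Euc n} {s r w τ : ℝ} (hθ : ‖θ‖ = 1)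
    (hws : w + r ≤ s / 2) (hs : 0 ≤ s) (hp : p ∈ slab θ s r τ) :
    1 - r + w * |τ| ≤ 1 + ‖p‖ := by
  have h1 := abs_real_inner_le_norm θ p
  rw [hθ, one_mul] at h1
  have h2 : |τ * s| - |⟪θ, p⟫| ≤ |⟪θ, p⟫ - τ * s| := by
    rw [abs_sub_comm]; exact abs_sub_abs_le_abs_sub _ _
  rw [abs_mul, abs_of_nonneg hs] at h2
  have h3 : |⟪θ, p⟫ - τ * s| ≤ s / 4 * |τ| + r * (1 + |τ|) := hp
  nlinarith [mul_le_mul_of_nonneg_right hws (abs_nonneg τ), mul_nonneg hs (abs_nonneg τ)]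

lemma norm_gradient_sub_le {V : Euc n → ℝ} (hV : ContDiff ℝ 2 V) {S : Set (Euc n)} {D : ℝ}
    (hS : Convex ℝ S) (hD : ∀ p ∈ S, ‖iteratedFDeriv ℝ 2 V p‖ ≤ D) {p q : Euc n} (hp : p ∈ S)
    (hq : q ∈ S) : ‖gradient V p - gradient V q‖ ≤ D * ‖p - q‖ := by
  rw [gradient, gradient, ← map_sub, LinearIsometryEquiv.norm_map]
  refine hS.norm_image_sub_le_of_norm_fderiv_le (𝕜 := ℝ) (f := fderiv ℝ V) (fun y _ => ?_)
    (fun y hy => ?_) hq hp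
  · exact ((hV.fderiv_right (m := 1) (by norm_num)).differentiable (by norm_num)) y
  · rw [← norm_iteratedFDeriv_one, norm_iteratedFDeriv_fderiv]
    exact hD y hy

lemma continuous_gradient {V : Euc n → ℝ} (hV : ContDiff ℝ 2 V) : Continuous (gradient V) := by
  have h : Continuous (fderiv ℝ V) := hV.continuous_fderiv (by norm_num)
  exact (LinearIsometryEquiv.continuous _).comp h

/-- decay of a long range field `Fl` and a short range field `Fs` on a family of sets. -/
structure FieldBounds (α β c w : ℝ) (S : ℝ → Set (Euc n)) (Fl Fs : Euc n → Euc n) : Prop where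
  cont_l : Continuous Fl
  cont_s : Continuous Fs
  norm_l : ∀ τ, ∀ p ∈ S τ, ‖Fl p‖ ≤ β * (c + w * |τ|) ^ (-(α + 1))
  sub_l : ∀ τ, ∀ p ∈ S τ, ∀ q ∈ S τ, ‖Fl p - Fl q‖ ≤ β * (c + w * |τ|) ^ (-(α + 2)) * ‖p - q‖
  norm_s : ∀ τ, ∀ p ∈ S τ, ‖Fs p‖ ≤ β * (c + w * |τ|) ^ (-(α + 2))
  norm_s' : ∀ τ, ∀ p ∈ S τ, ‖Fs p‖ ≤ β * (c + w * |τ|) ^ (-(α + 1))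
  sub_s : ∀ τ, ∀ p ∈ S τ, ∀ q ∈ S τ, ‖Fs p - Fs q‖ ≤ β * (c + w * |τ|) ^ (-(α + 3)) * ‖p - q‖

lemma LongRange.fieldBounds {α βl0 βl1 βl2 βs1 βs2 βs3 : ℝ} {Vl Vs : Euc n → ℝ}
    {Fl Fs : Euc n → Euc n} (hα : 0 < α) (hVl : LongRange α βl0 βl1 βl2 Vl)
    (hVs : ShortRange α βs1 βs2 βs3 Vs) (hβl1 : 0 < βl1)
    (hFl : ∀ y, Fl y = -gradient Vl y) (hFs : ∀ y, Fs y = -gradient Vs y)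
    {θ : Euc n} {s r w : ℝ} (hθ : ‖θ‖ = 1) (hs : 0 ≤ s) (hw : 0 < w) (hr : r < 1)
    (hws : w + r ≤ s / 2) :
    FieldBounds α (max βl1 (max βl2 (max βs2 βs3))) (1 - r) w (slab θ s r) Fl Fs := by
  obtain rfl : Fl = fun y => -gradient Vl y := funext hFl
  obtain rfl : Fs = fun y => -gradient Vs y := funext hFs
  set β := max βl1 (max βl2 (max βs2 βs3)) with hβ
  have b1 : βl1 ≤ β := le_max_left _ _
  have b2 : βl2 ≤ β := (le_max_left _ _).trans (le_max_right _ _)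
  have b3 : βs2 ≤ β := (le_max_left _ _).trans ((le_max_right _ _).trans (le_max_right _ _))
  have b4 : βs3 ≤ β := (le_max_right _ _).trans ((le_max_right _ _).trans (le_max_right _ _))
  have hβ0 : 0 ≤ β := hβl1.le.trans b1
  have key : ∀ (τ : ℝ) (p : Euc n), p ∈ slab θ s r τ → ∀ (b m m' C : ℝ), 0 ≤ m' → m' ≤ m →
      b ≤ β → C ≤ b * (1 + ‖p‖) ^ (-m) → C ≤ β * (1 - r + w * |τ|) ^ (-m') := by
    intro τ p hp b m m' C hm' hm hb hC
    have h1 := one_add_norm_ge_of_mem_slab (w := w) hθ hws hs hp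
    have h2 : 0 < 1 - r + w * |τ| := by
      have := mul_nonneg hw.le (abs_nonneg τ); linarith
    have h3 : (1 + ‖p‖) ^ (-m) ≤ (1 + ‖p‖) ^ (-m') :=
      rpow_le_rpow_of_exponent_le (by linarith [norm_nonneg p]) (by linarith)
    have h4 : (1 + ‖p‖) ^ (-m') ≤ (1 - r + w * |τ|) ^ (-m') :=
      rpow_le_rpow_of_nonpos h2 h1 (by linarith)
    calc C ≤ b * (1 + ‖p‖) ^ (-m) := hC
      _ ≤ β * (1 - r + w * |τ|) ^ (-m') := by
        refine mul_le_mul hb (h3.trans h4) (by positivity) hβ0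
  refine ⟨(continuous_gradient hVl.1).neg, (continuous_gradient hVs.1).neg, ?_, ?_, ?_, ?_, ?_⟩
  · intro τ p hp
    exact key τ p hp βl1 _ _ _ (by linarith) le_rfl b1 (by simpa using hVl.2.2.1 p)
  · intro τ p hp q hq
    rw [neg_sub_neg, norm_sub_rev]
    exact norm_gradient_sub_le hVl.1 (convex_slab θ s r τ) (fun y hy =>
      key τ y hy βl2 _ _ _ (by linarith) le_rfl b2 (hVl.2.2.2 y)) hp hq
  · intro τ p hp
    exact key τ p hp βs2 _ _ _ (by linarith) le_rfl b3 (by simpa using hVs.2.2.1 p)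
  · intro τ p hp
    exact key τ p hp βs2 (α + 2) _ _ (by linarith) (by linarith) b3
      (by simpa using hVs.2.2.1 p)
  · intro τ p hp q hq
    rw [neg_sub_neg, norm_sub_rev]
    exact norm_gradient_sub_le hVs.1 (convex_slab θ s r τ) (fun y hy =>
      key τ y hy βs3 _ _ _ (by linarith) le_rfl b4 (hVs.2.2.2 y)) hp hq

/-- a linear growth bound improves to a uniform bound under repeated halving. -/
lemma norm_le_two_mul_of_halving {δ : ℝ → Euc n} {K N : ℝ} (hK : 0 ≤ K) (hN : 0 ≤ N)
    (h0 : ∀ t, 0 ≤ t → ‖δ t‖ ≤ N * (1 + t))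
    (h : ∀ A B : ℝ, 0 ≤ A → 0 ≤ B → (∀ t, 0 ≤ t → ‖δ t‖ ≤ A + B * (1 + t)) →
      ∀ t, 0 ≤ t → ‖δ t‖ ≤ K + (A + B * (1 + t)) / 2) :
    ∀ t, 0 ≤ t → ‖δ t‖ ≤ 2 * K := by
  have hm : ∀ m : ℕ, ∀ t, 0 ≤ t → ‖δ t‖ ≤ 2 * K + N * (1 / 2) ^ m * (1 + t) := by
    intro m
    induction m with
    | zero => intro t ht; have := h0 t ht; simp; linarith
    | succ m ih =>
      intro t ht
      refine (h (2 * K) (N * (1 / 2) ^ m) (by positivity) (by positivity) ih t ht).trans_eq ?_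
      rw [pow_succ]; ring
  intro t ht
  have hlim : Tendsto (fun m : ℕ => 2 * K + N * (1 / 2) ^ m * (1 + t)) atTop (𝓝 (2 * K)) := by
    have := tendsto_pow_atTop_nhds_zero_of_lt_one (r := (1 / 2 : ℝ)) (by norm_num) (by norm_num)
    simpa using ((this.const_mul N).mul_const (1 + t)).const_add (2 * K)
  exact ge_of_tendsto' hlim fun m => hm m t ht

lemma MemM.norm_le {r : ℝ} {f : ℝ → Euc n} (hf : MemM r f) (t : ℝ) :
    (t ≤ 0 → ‖f t‖ ≤ r) ∧ (0 ≤ t → ‖f t‖ ≤ r * (1 + t)) := by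
  obtain ⟨-, h1, h2, h3⟩ := hf
  have n1 : 0 ≤ sSup ((fun t => ‖f t‖) '' Iic 0) :=
    (norm_nonneg (f 0)).trans (le_csSup h1 ⟨0, mem_Iic.2 le_rfl, rfl⟩)
  have n2 : 0 ≤ sSup ((fun t => ‖f t‖ / (1 + t)) '' Ici 0) :=
    le_trans (by positivity) (le_csSup h2 ⟨0, mem_Ici.2 le_rfl, rfl⟩ : ‖f 0‖ / (1 + 0) ≤ _)
  unfold Mnorm at h3
  constructor
  · intro ht
    have : ‖f t‖ ≤ _ := le_csSup h1 ⟨t, ht, rfl⟩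
    linarith
  · intro ht
    have : ‖f t‖ / (1 + t) ≤ _ := le_csSup h2 ⟨t, ht, rfl⟩
    rw [← div_le_iff₀ (by linarith)]
    linarith

/-! ### The incoming trajectory -/

/-- the incoming trajectory `zm + x + ym`, compared with the free motion `τ ↦ τ s θ + x`;
here `ym` is a fixed point of the map `A` and the constant `k` measures the total force. -/
structure Incoming (α β c w r s C k : ℝ) (θ x : Euc n) (Fl Fs : Euc n → Euc n)
    (zm ym : ℝ → Euc n) : Prop where
  α_pos : 0 < α
  β_pos : 0 < β
  c_pos : 0 < c
  c_le : c ≤ 1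
  w_pos : 0 < w
  r_pos : 0 < r
  r_le : r ≤ 1
  le_s : 2 * w ≤ s
  k_eq : k = β * c ^ (-α) / (α * w)
  small : k * (1 + 1 / w) ^ 2 ≤ c ^ 2 / 8
  bounds : FieldBounds α β c w (slab θ s r) Fl Fs
  norm_θ : ‖θ‖ = 1
  perp : ⟪θ, x⟫ = 0
  C_nonneg : 0 ≤ C
  C_le : C ≤ s / 8
  zm_sol : IsFreeSol Fl 0 (s • θ) atBot C zm
  ym_cont : Continuous ym
  ym_nonpos : ∀ t, t ≤ 0 → ‖ym t‖ ≤ r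
  ym_nonneg : ∀ t, 0 ≤ t → ‖ym t‖ ≤ r * (1 + t)
  ym_eq : ∀ t, ym t = ∫ σ in Iic t, ∫ τ in Iic σ, (Fl (zm τ + x + ym τ) + Fs (zm τ + x + ym τ)
    - Fl (zm τ))

namespace Incoming

variable {α β c w r s C k : ℝ} {θ x : Euc n} {Fl Fs : Euc n → Euc n} {zm ym : ℝ → Euc n}
  (S : Incoming α β c w r s C k θ x Fl Fs zm ym)

include S

lemma s_pos : 0 < s := by linarith [S.w_pos, S.le_s]

lemma k_pos : 0 < k := by
  have := S.α_pos; have := S.β_pos; have := S.c_pos; have := S.w_pos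
  rw [S.k_eq]; positivity

lemma density_pos (τ : ℝ) : 0 < c + w * |τ| := by
  have := mul_nonneg S.w_pos.le (abs_nonneg τ)
  linarith [S.c_pos]

lemma zm_cont : Continuous zm := S.zm_sol.1.continuous

lemma norm_zm_sub (τ : ℝ) : ‖zm τ - τ • (s • θ)‖ ≤ C * |τ| := by
  simpa using S.zm_sol.2.2.2.2 τ

lemma norm_ym_le (τ : ℝ) : ‖ym τ‖ ≤ r * (1 + |τ|) := by
  rcases le_total τ 0 with h | h
  · have := mul_nonneg S.r_pos.le (abs_nonneg τ)
    linarith [S.ym_nonpos τ h]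
  · rw [abs_of_nonneg h]; exact S.ym_nonneg τ h

lemma traj_cont : Continuous fun τ => zm τ + x + ym τ :=
  (S.zm_cont.add continuous_const).add S.ym_cont

lemma C_mul_le (τ : ℝ) : C * |τ| ≤ s / 8 * |τ| := mul_le_mul_of_nonneg_right S.C_le (abs_nonneg τ)

lemma mem_slab_of_norm_le {v p : Euc n} {τ : ℝ} (hv : ⟪θ, v⟫ = 0)
    (hp : ‖p - (τ • (s • θ) + v)‖ ≤ C * |τ| + r * (1 + |τ|)) : p ∈ slab θ s r τ := by
  refine mem_slab S.norm_θ hv (hp.trans ?_)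
  have h1 := S.C_mul_le τ
  have h2 := mul_nonneg S.s_pos.le (abs_nonneg τ)
  linarith

lemma error_nonneg (τ : ℝ) : 0 ≤ r * (1 + |τ|) := mul_nonneg S.r_pos.le (by positivity)

lemma zm_mem (τ : ℝ) : zm τ ∈ slab θ s r τ := by
  refine S.mem_slab_of_norm_le (v := 0) (by simp) ?_
  rw [add_zero]
  linarith [S.norm_zm_sub τ, S.error_nonneg τ]

lemma zm_add_mem (τ : ℝ) : zm τ + x ∈ slab θ s r τ := by
  refine S.mem_slab_of_norm_le S.perp ?_
  rw [add_sub_add_right_eq_sub]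
  linarith [S.norm_zm_sub τ, S.error_nonneg τ]

lemma free_mem (τ : ℝ) : τ • (s • θ) + x ∈ slab θ s r τ := by
  refine S.mem_slab_of_norm_le S.perp ?_
  rw [sub_self, norm_zero]
  linarith [mul_nonneg S.C_nonneg (abs_nonneg τ), S.error_nonneg τ]

lemma norm_traj_sub (τ : ℝ) :
    ‖zm τ + x + ym τ - (τ • (s • θ) + x)‖ ≤ ‖ym τ‖ + C * |τ| := by
  have h : zm τ + x + ym τ - (τ • (s • θ) + x) = ym τ + (zm τ - τ • (s • θ)) := by abel
  rw [h]
  exact (norm_add_le _ _).trans (by linarith [S.norm_zm_sub τ])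

lemma traj_mem (τ : ℝ) : zm τ + x + ym τ ∈ slab θ s r τ := by
  refine S.mem_slab_of_norm_le S.perp ((S.norm_traj_sub τ).trans ?_)
  linarith [S.norm_ym_le τ]

lemma force_cont : Continuous fun τ => Fl (zm τ + x + ym τ) + Fs (zm τ + x + ym τ) :=
  (S.bounds.cont_l.comp S.traj_cont).add (S.bounds.cont_s.comp S.traj_cont)

lemma norm_force_le (τ : ℝ) : ‖Fl (zm τ + x + ym τ) + Fs (zm τ + x + ym τ)‖ ≤
    2 * β * (c + w * |τ|) ^ (-(α + 1)) := by
  refine (norm_add_le _ _).trans ?_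
  linarith [S.bounds.norm_l τ _ (S.traj_mem τ), S.bounds.norm_s' τ _ (S.traj_mem τ)]

/-- continuous functions with the decay of the long range force are integrable. -/
lemma integrable_of_le {g : ℝ → Euc n} (hg : Continuous g) {M : ℝ}
    (h : ∀ τ, ‖g τ‖ ≤ M * (c + w * |τ|) ^ (-(α + 1))) :
    Integrable g ∧ ∫ τ, ‖g τ‖ ≤ 2 * M / β * k := by
  have h1 := integral_abs_affine_rpow S.c_pos S.w_pos S.α_pos
  have h2 : Integrable g := Integrable.mono' (h1.1.const_mul M) hg.aestronglyMeasurable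
    (Eventually.of_forall h)
  refine ⟨h2, (integral_mono h2.norm (h1.1.const_mul M) h).trans_eq ?_⟩
  rw [integral_const_mul, h1.2, S.k_eq]
  have := S.β_pos
  field_simp

lemma integrable_force : Integrable (fun τ => Fl (zm τ + x + ym τ) + Fs (zm τ + x + ym τ)) :=
  (S.integrable_of_le S.force_cont S.norm_force_le).1

lemma norm_integral_force_le :
    ‖∫ τ, (Fl (zm τ + x + ym τ) + Fs (zm τ + x + ym τ))‖ ≤ 4 * k := by
  refine (norm_integral_le_integral_norm _).trans
    ((S.integrable_of_le S.force_cont S.norm_force_le).2.trans_eq ?_)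
  have := S.β_pos
  field_simp
  ring

lemma integrable_zm : Integrable (fun τ => Fl (zm τ)) :=
  (S.integrable_of_le (S.bounds.cont_l.comp S.zm_cont)
    (fun τ => S.bounds.norm_l τ _ (S.zm_mem τ))).1

lemma diff_cont :
    Continuous fun τ => Fl (zm τ + x + ym τ) + Fs (zm τ + x + ym τ) - Fl (zm τ) :=
  S.force_cont.sub (S.bounds.cont_l.comp S.zm_cont)

lemma integrable_diff :
    Integrable (fun τ => Fl (zm τ + x + ym τ) + Fs (zm τ + x + ym τ) - Fl (zm τ)) :=
  S.integrable_force.sub S.integrable_zm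

lemma norm_integral_diff_le (t : ℝ) :
    ‖∫ τ in Iic t, (Fl (zm τ + x + ym τ) + Fs (zm τ + x + ym τ) - Fl (zm τ))‖ ≤ 6 * k := by
  have h := S.integrable_of_le S.diff_cont (M := 3 * β) fun τ => by
    refine (norm_sub_le _ _).trans ?_
    linarith [S.norm_force_le τ, S.bounds.norm_l τ _ (S.zm_mem τ)]
  refine (norm_integral_le_integral_norm _).trans
    ((setIntegral_le_integral h.1.norm (Eventually.of_forall fun _ => norm_nonneg _)).trans
      (h.2.trans_eq ?_))
  have := S.β_pos
  field_simp
  ring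

lemma tailDecay_diff_neg : TailDecay α c w (β * (‖x‖ + 2)) (fun τ =>
    Fl (zm (-τ) + x + ym (-τ)) + Fs (zm (-τ) + x + ym (-τ)) - Fl (zm (-τ))) := by
  refine ⟨S.diff_cont.comp continuous_neg, fun τ hτ => ?_⟩
  have e : c + w * |-τ| = c + w * τ := by rw [abs_neg, abs_of_nonneg hτ]
  have h1 := S.bounds.sub_l (-τ) _ (S.traj_mem (-τ)) _ (S.zm_mem (-τ))
  have h2 := S.bounds.norm_s (-τ) _ (S.traj_mem (-τ))
  rw [e] at h1 h2
  have h3 : ‖zm (-τ) + x + ym (-τ) - zm (-τ)‖ ≤ ‖x‖ + 1 := by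
    have : zm (-τ) + x + ym (-τ) - zm (-τ) = x + ym (-τ) := by abel
    rw [this]
    exact (norm_add_le _ _).trans (by linarith [S.ym_nonpos (-τ) (by linarith), S.r_le])
  have h4 : 0 ≤ β * (c + w * τ) ^ (-(α + 2)) := by
    rw [← e]
    exact mul_nonneg S.β_pos.le (rpow_nonneg (S.density_pos _).le _)
  beta_reduce
  rw [add_sub_right_comm]
  refine (norm_add_le _ _).trans ?_
  linarith [mul_le_mul_of_nonneg_left h3 h4]

lemma norm_ym_le_of_nonpos {t : ℝ} (ht : t ≤ 0) : ‖ym t‖ ≤ (‖x‖ + 2) * (k / w) := by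
  have hβ := S.β_pos
  have hw := S.w_pos
  rw [S.ym_eq t, integral_integral_Iic_eq_Ici_neg]
  refine (S.tailDecay_diff_neg.norm_integral_integral_le S.α_pos S.c_pos S.w_pos
    (by positivity) (by linarith)).trans_eq ?_
  rw [S.k_eq]
  field_simp

lemma cont_integral_diff : Continuous fun σ =>
    ∫ τ in Iic σ, (Fl (zm τ + x + ym τ) + Fs (zm τ + x + ym τ) - Fl (zm τ)) := by
  set g := fun τ => Fl (zm τ + x + ym τ) + Fs (zm τ + x + ym τ) - Fl (zm τ)
  have hgi : Integrable g := S.integrable_diff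
  have h : (fun σ => ∫ τ in Iic σ, g τ) =
      fun σ => (∫ τ in Iic 0, g τ) + ∫ τ in (0 : ℝ)..σ, g τ := by
    ext1 σ
    rw [← intervalIntegral.integral_Iic_sub_Iic hgi.integrableOn hgi.integrableOn]
    abel
  rw [h]
  exact continuous_const.add (intervalIntegral.continuous_primitive
    (fun a b => S.diff_cont.intervalIntegrable a b) 0)

lemma ym_sub_eq (t : ℝ) : ym t = ym 0 + ∫ σ in (0 : ℝ)..t,
    ∫ τ in Iic σ, (Fl (zm τ + x + ym τ) + Fs (zm τ + x + ym τ) - Fl (zm τ)) := by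
  have hβ := S.β_pos
  set g := fun τ => Fl (zm τ + x + ym τ) + Fs (zm τ + x + ym τ) - Fl (zm τ)
  have hcont : Continuous fun σ => ∫ τ in Iic σ, g τ := S.cont_integral_diff
  have h0 : IntegrableOn (fun σ => ∫ τ in Iic σ, g τ) (Iic 0) := by
    have h1 := (S.tailDecay_diff_neg.integrableOn_integral S.α_pos S.c_pos S.w_pos
      (by positivity) le_rfl).comp_neg
    simp only [neg_Ici, neg_zero] at h1
    refine h1.congr_fun (fun σ _ => ?_) measurableSet_Iic
    simpa using (integral_Iic_eq_integral_Ici_neg g σ).symm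
  have h1 : IntegrableOn (fun σ => ∫ τ in Iic σ, g τ) (Iic t) := by
    refine (h0.union (hcont.integrableOn_Icc (a := 0) (b := t))).mono_set fun σ hσ => ?_
    rcases le_total σ 0 with h | h
    · exact Or.inl h
    · exact Or.inr ⟨h, hσ⟩
  rw [← intervalIntegral.integral_Iic_sub_Iic h0 h1, S.ym_eq t, S.ym_eq 0]
  abel

lemma norm_ym_le_of_nonneg {t : ℝ} (ht : 0 ≤ t) :
    ‖ym t‖ ≤ (‖x‖ + 2) * (k / w) + 6 * k * t := by
  rw [S.ym_sub_eq t]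
  refine (norm_add_le _ _).trans (add_le_add (S.norm_ym_le_of_nonpos le_rfl) ?_)
  have := intervalIntegral.norm_integral_le_of_norm_le_const (a := 0) (b := t) (C := 6 * k)
    (f := fun σ => ∫ τ in Iic σ, (Fl (zm τ + x + ym τ) + Fs (zm τ + x + ym τ) - Fl (zm τ)))
    (fun σ _ => S.norm_integral_diff_le σ)
  rwa [sub_zero, abs_of_nonneg ht] at this

end Incoming

lemma IsFreeSol.differentiable_deriv {Fl : Euc n → Euc n} {x0 v : Euc n} {l : Filter ℝ} {C : ℝ}
    {z : ℝ → Euc n} (h : IsFreeSol Fl x0 v l C z) : Differentiable ℝ (deriv z) :=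
  (ContDiff.iterate_deriv' 1 1 (by simpa [one_add_one_eq_two] using h.1)).differentiable
    (by norm_num)

lemma IsFreeSol.hasDerivAt_deriv {Fl : Euc n → Euc n} {x0 v : Euc n} {l : Filter ℝ} {C : ℝ}
    {z : ℝ → Euc n} (h : IsFreeSol Fl x0 v l C z) (t : ℝ) : HasDerivAt (deriv z) (Fl (z t)) t := by
  rw [← h.2.1 t]
  exact (h.differentiable_deriv t).hasDerivAt

lemma IsFreeSol.integral_deriv {Fl : Euc n → Euc n} {v : Euc n} {l : Filter ℝ} {C : ℝ}
    {z : ℝ → Euc n} (h : IsFreeSol Fl 0 v l C z) (t : ℝ) : ∫ σ in (0 : ℝ)..t, deriv z σ = z t := by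
  rw [intervalIntegral.integral_deriv_eq_sub
    (fun y _ => h.1.differentiable (by norm_num) y)
    (h.differentiable_deriv.continuous.intervalIntegrable 0 t), h.2.2.1, sub_zero]

lemma Incoming.deriv_zm {α β c w r s C k : ℝ} {θ x : Euc n} {Fl Fs : Euc n → Euc n}
    {zm ym : ℝ → Euc n} (S : Incoming α β c w r s C k θ x Fl Fs zm ym) (t : ℝ) :
    deriv zm t = s • θ + ∫ τ in Iic t, Fl (zm τ) := by
  rw [integral_Iic_of_hasDerivAt_of_tendsto' (fun y _ => S.zm_sol.hasDerivAt_deriv y)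
    S.integrable_zm.integrableOn S.zm_sol.2.2.2.1, add_sub_cancel]

/-! ### The outgoing trajectory -/

/-- an incoming trajectory together with the free solution `zp` with the same final velocity. -/
structure Scattering (α β c w r s C k : ℝ) (θ x : Euc n) (Fl Fs : Euc n → Euc n)
    (zm ym : ℝ → Euc n) (a : Euc n) (C' : ℝ) (zp : ℝ → Euc n) : Prop
    extends Incoming α β c w r s C k θ x Fl Fs zm ym where
  a_eq : a = s • θ + ∫ τ, (Fl (zm τ + x + ym τ) + Fs (zm τ + x + ym τ))
  zp_sol : IsFreeSol Fl 0 a atTop C' zp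
  C'_le : C' ≤ s / 4 - 4 * k

namespace Scattering

variable {α β c w r s C k C' : ℝ} {θ x a : Euc n} {Fl Fs : Euc n → Euc n} {zm ym zp : ℝ → Euc n}
  (S : Scattering α β c w r s C k θ x Fl Fs zm ym a C' zp)

include S

lemma zp_cont : Continuous zp := S.zp_sol.1.continuous

lemma norm_zp_sub (τ : ℝ) : ‖zp τ - τ • (s • θ)‖ ≤ s / 4 * |τ| := by
  have h1 : ‖zp τ - τ • a‖ ≤ C' * |τ| := by simpa using S.zp_sol.2.2.2.2 τ
  have h2 : ‖a - s • θ‖ ≤ 4 * k := by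
    rw [S.a_eq, add_sub_cancel_left]
    exact S.norm_integral_force_le
  have h3 : zp τ - τ • (s • θ) = (zp τ - τ • a) + τ • (a - s • θ) := by
    rw [smul_sub]; abel
  rw [h3]
  refine (norm_add_le _ _).trans ?_
  rw [norm_smul, Real.norm_eq_abs]
  have h4 := mul_le_mul_of_nonneg_right S.C'_le (abs_nonneg τ)
  have h5 := mul_le_mul_of_nonneg_left h2 (abs_nonneg τ)
  linarith

lemma zp_mem (τ : ℝ) : zp τ ∈ slab θ s r τ := by
  refine mem_slab (v := 0) S.norm_θ (by simp) ?_
  rw [add_zero]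
  linarith [S.norm_zp_sub τ, S.error_nonneg τ]

lemma zp_add_mem (τ : ℝ) : zp τ + x ∈ slab θ s r τ := by
  refine mem_slab S.norm_θ S.perp ?_
  rw [add_sub_add_right_eq_sub]
  linarith [S.norm_zp_sub τ, S.error_nonneg τ]

lemma integrable_zp : Integrable (fun τ => Fl (zp τ)) :=
  (S.integrable_of_le (S.bounds.cont_l.comp S.zp_cont)
    (fun τ => S.bounds.norm_l τ _ (S.zp_mem τ))).1

lemma deriv_zp (t : ℝ) : deriv zp t = a - ∫ τ in Ioi t, Fl (zp τ) := by
  rw [integral_Ioi_of_hasDerivAt_of_tendsto' (fun y _ => S.zp_sol.hasDerivAt_deriv y)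
    S.integrable_zp.integrableOn S.zp_sol.2.2.2.1, sub_sub_cancel]

lemma velocity_gap (t : ℝ) :
    deriv zm t + (∫ τ in Iic t, (Fl (zm τ + x + ym τ) + Fs (zm τ + x + ym τ) - Fl (zm τ)))
      - deriv zp t =
    -∫ τ in Ici t, (Fl (zm τ + x + ym τ) + Fs (zm τ + x + ym τ) - Fl (zp τ)) := by
  have h1 := intervalIntegral.integral_Iic_add_Ioi (b := t) S.integrable_force.integrableOn
    S.integrable_force.integrableOn
  rw [S.deriv_zm, S.deriv_zp, S.a_eq, ← h1,
    integral_sub S.integrable_force.integrableOn S.integrable_zm.integrableOn,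
    integral_sub S.integrable_force.integrableOn S.integrable_zp.integrableOn,
    integral_Ici_eq_integral_Ioi, integral_Ici_eq_integral_Ioi]
  abel

lemma gap_eq (t : ℝ) : zm t + ym t - zp t = ym 0 + ∫ σ in (0 : ℝ)..t,
    -∫ τ in Ici σ, (Fl (zm τ + x + ym τ) + Fs (zm τ + x + ym τ) - Fl (zp τ)) := by
  have h1 := S.zm_sol.differentiable_deriv.continuous.intervalIntegrable 0 t (μ := volume)
  have h2 := S.zp_sol.differentiable_deriv.continuous.intervalIntegrable 0 t (μ := volume)
  have h3 := S.cont_integral_diff.intervalIntegrable 0 t (μ := volume)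
  simp_rw [← S.velocity_gap]
  rw [intervalIntegral.integral_sub (h1.add h3) h2, intervalIntegral.integral_add h1 h3,
    S.zm_sol.integral_deriv, S.zp_sol.integral_deriv, S.ym_sub_eq t]
  abel

lemma small_div : k / w ≤ 1 / 8 := by
  have hw := S.w_pos
  have hk := S.k_pos
  have h1 : k / w ≤ k * (1 + 1 / w) ^ 2 := by
    rw [div_eq_mul_one_div]
    gcongr
    have : 0 < 1 / w := by positivity
    nlinarith
  have h2 : c ^ 2 ≤ 1 := pow_le_one₀ S.c_pos.le S.c_le
  linarith [S.small]

lemma small_mul : k * (1 + 1 / w) / c ≤ 1 / 8 := by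
  have hw := S.w_pos
  have hk := S.k_pos
  have hc := S.c_pos
  rw [div_le_iff₀ hc]
  have h1 : k * (1 + 1 / w) ≤ k * (1 + 1 / w) ^ 2 := by
    gcongr
    have : 0 < 1 / w := by positivity
    nlinarith
  nlinarith [S.small, S.c_le]

lemma gap_bound_improves {A B : ℝ} (hA : 0 ≤ A) (hB : 0 ≤ B)
    (h : ∀ t, 0 ≤ t → ‖zm t + ym t - zp t‖ ≤ A + B * (1 + t)) {t : ℝ} (ht : 0 ≤ t) :
    ‖zm t + ym t - zp t‖ ≤ (2 * ‖x‖ + 3) * (k / w) + (A + B * (1 + t)) / 2 := by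
  have hα := S.α_pos
  have hβ := S.β_pos
  have hc := S.c_pos
  have hw := S.w_pos
  have hk := S.k_pos
  set M := β * (1 + ‖x‖ + A) with hM
  set M' := β * B * ((1 + 1 / w) / c) with hM'
  have hM0 : 0 ≤ M := by positivity
  have hM'0 : 0 ≤ M' := by positivity
  have hpt : ∀ τ, 0 ≤ τ → ‖Fl (zm τ + x + ym τ) + Fs (zm τ + x + ym τ) - Fl (zp τ)‖ ≤
      M * (c + w * τ) ^ (-(α + 1 + 1)) + M' * (c + w * τ) ^ (-(α + 1)) := by
    intro τ hτ
    have e : |τ| = τ := abs_of_nonneg hτ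
    have hρ : 0 < c + w * τ := by positivity
    have h1 := S.bounds.sub_l τ _ (S.traj_mem τ) _ (S.zp_mem τ)
    have h2 := S.bounds.norm_s τ _ (S.traj_mem τ)
    rw [e] at h1 h2
    have h3 : ‖zm τ + x + ym τ - zp τ‖ ≤ ‖x‖ + A + B * (1 + τ) := by
      have : zm τ + x + ym τ - zp τ = x + (zm τ + ym τ - zp τ) := by abel
      rw [this]
      exact (norm_add_le _ _).trans (by linarith [h τ hτ])
    have h4 : 1 + τ ≤ (1 + 1 / w) / c * (c + w * τ) := by
      have : (1 + 1 / w) / c * (c + w * τ) = 1 + 1 / w + (w * τ + τ) / c := by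
        field_simp
      rw [this]
      have h5 : τ ≤ (w * τ + τ) / c := by
        rw [le_div_iff₀ hc]
        nlinarith [mul_nonneg hw.le hτ, S.c_le, mul_le_mul_of_nonneg_left S.c_le hτ]
      have : 0 < 1 / w := by positivity
      linarith
    have h6 : (c + w * τ) * (c + w * τ) ^ (-(α + 2)) = (c + w * τ) ^ (-(α + 1)) := by
      rw [← rpow_one_add' hρ.le (by linarith)]
      congr 1; ring
    have e2 : -(α + 1 + 1) = -(α + 2) := by ring
    rw [e2, add_sub_right_comm]
    refine (norm_add_le _ _).trans ?_
    have h7 : 0 < (c + w * τ) ^ (-(α + 2)) := rpow_pos_of_pos hρ _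
    calc _ ≤ β * (c + w * τ) ^ (-(α + 2)) *
          (‖x‖ + A + B * ((1 + 1 / w) / c * (c + w * τ))) + β * (c + w * τ) ^ (-(α + 2)) := by
          refine add_le_add (h1.trans ?_) h2
          refine mul_le_mul_of_nonneg_left (h3.trans ?_) (by positivity)
          gcongr
      _ = M * (c + w * τ) ^ (-(α + 2)) + M' * ((c + w * τ) * (c + w * τ) ^ (-(α + 2))) := by
          rw [hM, hM']; ring
      _ = _ := by rw [h6]
  have hinner : ∀ σ, 0 ≤ σ →
      ‖-∫ τ in Ici σ, (Fl (zm τ + x + ym τ) + Fs (zm τ + x + ym τ) - Fl (zp τ))‖ ≤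
      M / w * (c + w * σ) ^ (-(α + 1)) + B * (1 / 8) := by
    intro σ hσ
    have i1 := integral_affine_rpow (p := α + 1) hc hw (by linarith) hσ
    have i2 := integral_affine_rpow hc hw hα hσ
    rw [norm_neg]
    have h1 := norm_integral_le_of_norm_le ((i1.1.const_mul M).add (i2.1.const_mul M'))
      (f := fun τ => Fl (zm τ + x + ym τ) + Fs (zm τ + x + ym τ) - Fl (zp τ)) (by
        filter_upwards [ae_restrict_mem measurableSet_Ici] with τ hτ
        exact hpt τ (hσ.trans hτ))
    refine h1.trans ?_
    simp only [Pi.add_apply]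
    rw [integral_add (i1.1.const_mul M) (i2.1.const_mul M'), integral_const_mul,
      integral_const_mul, i1.2, i2.2]
    have hρ : 0 < c + w * σ := by positivity
    have h3 : 0 < (c + w * σ) ^ (-(α + 1)) := rpow_pos_of_pos hρ _
    refine add_le_add ?_ ?_
    · rw [div_mul_eq_mul_div, mul_div_assoc]
      gcongr
      nlinarith
    · have h4 : (c + w * σ) ^ (-α) ≤ c ^ (-α) :=
        rpow_le_rpow_of_nonpos hc (by nlinarith [mul_nonneg hw.le hσ]) (by linarith)
      calc M' * ((c + w * σ) ^ (-α) / (α * w)) ≤ M' * (c ^ (-α) / (α * w)) := by gcongr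
        _ = B * (k * (1 + 1 / w) / c) := by rw [hM', S.k_eq]; field_simp
        _ ≤ B * (1 / 8) := mul_le_mul_of_nonneg_left S.small_mul hB
  have i2 := integral_affine_rpow hc hw hα le_rfl
  have i3 : IntegrableOn (fun σ : ℝ => (c + w * σ) ^ (-(α + 1))) (Ioc 0 t) :=
    i2.1.mono_set (Ioc_subset_Icc_self.trans Icc_subset_Ici_self)
  have i4 : IntervalIntegrable (fun σ : ℝ => (c + w * σ) ^ (-(α + 1))) volume 0 t :=
    (intervalIntegrable_iff_integrableOn_Ioc_of_le ht).2 i3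
  have houter : ‖∫ σ in (0 : ℝ)..t,
      -∫ τ in Ici σ, (Fl (zm τ + x + ym τ) + Fs (zm τ + x + ym τ) - Fl (zp τ))‖ ≤
      (1 + ‖x‖ + A) * (k / w) + t * (B * (1 / 8)) := by
    refine (intervalIntegral.norm_integral_le_of_norm_le ht
      (Eventually.of_forall fun σ hσ => hinner σ hσ.1.le)
      ((i4.const_mul (M / w)).add intervalIntegrable_const)).trans ?_
    rw [intervalIntegral.integral_add (i4.const_mul (M / w)) intervalIntegrable_const,
      intervalIntegral.integral_const_mul, intervalIntegral.integral_const, smul_eq_mul, sub_zero]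
    refine add_le_add ?_ le_rfl
    have h5 : ∫ σ in (0 : ℝ)..t, (c + w * σ) ^ (-(α + 1)) ≤ c ^ (-α) / (α * w) := by
      rw [intervalIntegral.integral_of_le ht]
      refine (setIntegral_mono_set i2.1 ?_
        (Ioc_subset_Icc_self.trans Icc_subset_Ici_self).eventuallyLE).trans_eq ?_
      · filter_upwards [ae_restrict_mem measurableSet_Ici] with σ hσ
        have : 0 ≤ w * σ := mul_nonneg hw.le hσ
        exact rpow_nonneg (by linarith) _
      · rw [i2.2, mul_zero, add_zero]
    calc _ ≤ M / w * (c ^ (-α) / (α * w)) := by gcongr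
      _ = _ := by rw [hM, S.k_eq]; field_simp
  rw [S.gap_eq t]
  refine (norm_add_le _ _).trans ((add_le_add (S.norm_ym_le_of_nonpos le_rfl) houter).trans ?_)
  have h6 := mul_le_mul_of_nonneg_left S.small_div hA
  have h7 := mul_nonneg hB ht
  linarith

lemma norm_gap_le {t : ℝ} (ht : 0 ≤ t) :
    ‖zm t + ym t - zp t‖ ≤ 2 * ((2 * ‖x‖ + 3) * (k / w)) := by
  have hw := S.w_pos
  have hk := S.k_pos
  have hs := S.s_pos
  have hr := S.r_pos
  refine norm_le_two_mul_of_halving (N := s + r) (by positivity) (by positivity) (fun t ht => ?_)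
    (fun A B hA hB h t ht => S.gap_bound_improves hA hB h ht) t ht
  have h1 := S.norm_zm_sub t
  have h2 := S.norm_zp_sub t
  have h3 := S.ym_nonneg t ht
  have h4 := S.C_mul_le t
  rw [abs_of_nonneg ht] at h1 h2 h4
  have h5 : zm t + ym t - zp t = (zm t - t • (s • θ)) - (zp t - t • (s • θ)) + ym t := by abel
  rw [h5]
  refine (norm_add_le _ _).trans ((add_le_add (norm_sub_le _ _) le_rfl).trans ?_)
  nlinarith [mul_nonneg hs.le ht]

lemma tailDecay_gap : TailDecay α c w (β * (2 * ((2 * ‖x‖ + 3) * (k / w))))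
    (fun τ => Fl (zm τ + x + ym τ) - Fl (zp τ + x)) := by
  refine ⟨(S.bounds.cont_l.comp S.traj_cont).sub
    (S.bounds.cont_l.comp (S.zp_cont.add continuous_const)), fun τ hτ => ?_⟩
  have h1 := S.bounds.sub_l τ _ (S.traj_mem τ) _ (S.zp_add_mem τ)
  have h2 : zm τ + x + ym τ - (zp τ + x) = zm τ + ym τ - zp τ := by abel
  rw [h2] at h1
  have h3 := mul_le_mul_of_nonneg_left (S.norm_gap_le hτ)
    (mul_nonneg S.β_pos.le (rpow_nonneg (S.density_pos τ).le (-(α + 2))))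
  rw [abs_of_nonneg hτ] at h1 h3
  exact h1.trans (h3.trans_eq (by ring))

end Scattering

lemma continuous_free (s : ℝ) (θ x : Euc n) : Continuous fun τ : ℝ => τ • (s • θ) + x := by
  fun_prop

namespace Incoming

variable {α β c w r s C k : ℝ} {θ x : Euc n} {Fl Fs : Euc n → Euc n} {zm ym : ℝ → Euc n}
  (S : Incoming α β c w r s C k θ x Fl Fs zm ym)

include S

lemma norm_short_sub_le {Y L τ : ℝ} (hY : 0 ≤ Y) (hL : 0 ≤ L)
    (h : ‖zm τ + x + ym τ - (τ • (s • θ) + x)‖ ≤ Y + L * |τ|) :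
    ‖Fs (zm τ + x + ym τ) - Fs (τ • (s • θ) + x)‖ ≤
      β * (Y / c + L / w) * (c + w * |τ|) ^ (-(α + 2)) := by
  have hα := S.α_pos
  have hβ := S.β_pos
  have hc := S.c_pos
  have hw := S.w_pos
  have hρ := S.density_pos τ
  have h1 := S.bounds.sub_s τ _ (S.traj_mem τ) _ (S.free_mem τ)
  have h2 : (c + w * |τ|) * (c + w * |τ|) ^ (-(α + 3)) = (c + w * |τ|) ^ (-(α + 2)) := by
    rw [← rpow_one_add' hρ.le (by linarith)]
    congr 1; ring
  have h3 : 0 < (c + w * |τ|) ^ (-(α + 3)) := rpow_pos_of_pos hρ _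
  have h4 : Y + L * |τ| ≤ (Y / c + L / w) * (c + w * |τ|) := by
    have : (Y / c + L / w) * (c + w * |τ|) = Y + L * |τ| + (Y / c * (w * |τ|) + L / w * c) := by
      field_simp; ring
    rw [this]
    have : 0 ≤ Y / c * (w * |τ|) + L / w * c := by positivity
    linarith
  calc _ ≤ β * (c + w * |τ|) ^ (-(α + 3)) * ((Y / c + L / w) * (c + w * |τ|)) :=
        h1.trans (mul_le_mul_of_nonneg_left (h.trans h4) (by positivity))
    _ = β * (Y / c + L / w) * ((c + w * |τ|) * (c + w * |τ|) ^ (-(α + 3))) := by ring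
    _ = _ := by rw [h2]

lemma tailDecay_long_neg : TailDecay α c w (β * ‖x‖)
    (fun τ => Fl (zm (-τ) + x) - Fl (zm (-τ))) := by
  refine ⟨((S.bounds.cont_l.comp (S.zm_cont.add continuous_const)).sub
    (S.bounds.cont_l.comp S.zm_cont)).comp continuous_neg, fun τ hτ => ?_⟩
  have h1 := S.bounds.sub_l (-τ) _ (S.zm_add_mem (-τ)) _ (S.zm_mem (-τ))
  rw [add_sub_cancel_left, abs_neg, abs_of_nonneg hτ] at h1
  exact h1.trans_eq (by ring)

lemma tailDecay_free : TailDecay α c w β (fun τ => Fs (τ • (s • θ) + x)) := by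
  refine ⟨S.bounds.cont_s.comp (continuous_free s θ x), fun τ hτ => ?_⟩
  have h1 := S.bounds.norm_s τ _ (S.free_mem τ)
  rwa [abs_of_nonneg hτ] at h1

lemma tailDecay_free_neg : TailDecay α c w β (fun τ => Fs ((-τ) • (s • θ) + x)) := by
  refine ⟨(S.bounds.cont_s.comp (continuous_free s θ x)).comp continuous_neg, fun τ hτ => ?_⟩
  have h1 := S.bounds.norm_s (-τ) _ (S.free_mem (-τ))
  rwa [abs_neg, abs_of_nonneg hτ] at h1

lemma tailDecay_short : TailDecay α c w β (fun τ => Fs (zm τ + x + ym τ)) := by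
  refine ⟨S.bounds.cont_s.comp S.traj_cont, fun τ hτ => ?_⟩
  have h1 := S.bounds.norm_s τ _ (S.traj_mem τ)
  rwa [abs_of_nonneg hτ] at h1

lemma tailDecay_short_sub : TailDecay α c w
    (β * ((‖x‖ + 2) * (k / w) / c + (6 * k + C) / w))
    (fun τ => Fs (zm τ + x + ym τ) - Fs (τ • (s • θ) + x)) := by
  have hk := S.k_pos
  have hw := S.w_pos
  have hC := S.C_nonneg
  refine ⟨(S.bounds.cont_s.comp S.traj_cont).sub (S.bounds.cont_s.comp (continuous_free s θ x)),
    fun τ hτ => ?_⟩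
  have h1 := S.norm_short_sub_le (Y := (‖x‖ + 2) * (k / w)) (L := 6 * k + C) (τ := τ)
    (by positivity) (by positivity) ((S.norm_traj_sub τ).trans (by
      have := S.norm_ym_le_of_nonneg hτ
      rw [abs_of_nonneg hτ]
      linarith))
  rwa [abs_of_nonneg hτ] at h1

lemma tailDecay_remainder_neg : TailDecay α c w
    (β * ((‖x‖ + 2) * (k / w) + ((‖x‖ + 2) * (k / w) / c + C / w)))
    (fun τ => Fl (zm (-τ) + x + ym (-τ)) + Fs (zm (-τ) + x + ym (-τ)) - Fl (zm (-τ))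
      - (Fl (zm (-τ) + x) - Fl (zm (-τ))) - Fs ((-τ) • (s • θ) + x)) := by
  have hk := S.k_pos
  have hw := S.w_pos
  have hβ := S.β_pos
  refine ⟨(S.tailDecay_diff_neg.1.sub S.tailDecay_long_neg.1).sub S.tailDecay_free_neg.1,
    fun τ hτ => ?_⟩
  have hy := S.norm_ym_le_of_nonpos (t := -τ) (by linarith)
  have h1 := S.norm_short_sub_le (Y := (‖x‖ + 2) * (k / w)) (L := C) (τ := -τ)
    (by positivity) S.C_nonneg ((S.norm_traj_sub (-τ)).trans (by linarith))
  have h2 := S.bounds.sub_l (-τ) _ (S.traj_mem (-τ)) _ (S.zm_add_mem (-τ))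
  rw [add_sub_cancel_left] at h2
  have h3 := mul_le_mul_of_nonneg_left hy
    (mul_nonneg S.β_pos.le (rpow_nonneg (S.density_pos (-τ)).le (-(α + 2))))
  rw [abs_neg, abs_of_nonneg hτ] at h1 h2 h3
  have h4 : Fl (zm (-τ) + x + ym (-τ)) + Fs (zm (-τ) + x + ym (-τ)) - Fl (zm (-τ))
      - (Fl (zm (-τ) + x) - Fl (zm (-τ))) - Fs ((-τ) • (s • θ) + x) =
      (Fl (zm (-τ) + x + ym (-τ)) - Fl (zm (-τ) + x)) +
      (Fs (zm (-τ) + x + ym (-τ)) - Fs ((-τ) • (s • θ) + x)) := by abel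
  beta_reduce
  rw [h4]
  refine (norm_add_le _ _).trans ((add_le_add (h2.trans h3) h1).trans_eq ?_)
  ring

end Incoming

lemma Scattering.norm_remainder_le {α β c w r s C k C' : ℝ} {θ x a : Euc n}
    {Fl Fs : Euc n → Euc n} {zm ym zp : ℝ → Euc n}
    (S : Scattering α β c w r s C k θ x Fl Fs zm ym a C' zp) :
    ‖((∫ σ in Iic (0 : ℝ), ∫ τ in Iic σ,
          (Fl (zm τ + x + ym τ) + Fs (zm τ + x + ym τ) - Fl (zm τ))) -
        (∫ σ in Iic (0 : ℝ), ∫ τ in Iic σ, (Fl (zm τ + x) - Fl (zm τ))) -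
        ∫ σ in Iic (0 : ℝ), ∫ τ in Iic σ, Fs (τ • (s • θ) + x)) -
      ((∫ σ in Ici (0 : ℝ), ∫ τ in Ici σ, Fs (zm τ + x + ym τ)) -
        ∫ σ in Ici (0 : ℝ), ∫ τ in Ici σ, Fs (τ • (s • θ) + x)) -
      ∫ σ in Ici (0 : ℝ), ∫ τ in Ici σ, (Fl (zm τ + x + ym τ) - Fl (zp τ + x))‖ ≤
    k / w * ((‖x‖ + 2) * (k / w) + 2 * ((‖x‖ + 2) * (k / w) / c) + (6 * k + 2 * C) / w +
      2 * ((2 * ‖x‖ + 3) * (k / w))) := by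
  have hα := S.α_pos
  have hβ := S.β_pos
  have hc := S.c_pos
  have hw := S.w_pos
  have hk := S.k_pos
  have hC := S.C_nonneg
  have d1 := S.tailDecay_diff_neg
  have d2 := S.tailDecay_long_neg
  rw [integral_integral_Iic_eq_Ici_neg, integral_integral_Iic_eq_Ici_neg,
    integral_integral_Iic_eq_Ici_neg, neg_zero,
    ← d1.integral_integral_sub hα hc hw (by positivity) (by positivity) d2,
    ← (d1.sub d2).integral_integral_sub hα hc hw (by positivity) (by positivity)
      S.tailDecay_free_neg,
    ← S.tailDecay_short.integral_integral_sub hα hc hw (by positivity) (by positivity)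
      S.tailDecay_free]
  have e1 := S.tailDecay_remainder_neg.norm_integral_integral_le hα hc hw (by positivity) le_rfl
  have e2 := S.tailDecay_short_sub.norm_integral_integral_le hα hc hw (by positivity) le_rfl
  have e3 := S.tailDecay_gap.norm_integral_integral_le hα hc hw (by positivity) le_rfl
  refine (norm_sub_le _ _).trans ((add_le_add ((norm_sub_le _ _).trans (add_le_add e1 e2))
    e3).trans_eq ?_)
  have h : c ^ (-α) / (α * w ^ 2) = k / w / β := by
    rw [S.k_eq]; field_simp
  rw [h]
  field_simp
  ring

/-! ### Numerical estimates -/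

lemma four_div_le_one_add_one_div_sq {w : ℝ} (hw : 0 < w) : 4 / w ≤ (1 + 1 / w) ^ 2 := by
  have h : (1 + 1 / w) ^ 2 - 4 / w = (1 - 1 / w) ^ 2 := by field_simp; ring
  linarith [sq_nonneg (1 - 1 / w)]

lemma remainder_const_le {N X c w k C : ℝ} (hN : 2 ≤ N) (hX : 0 ≤ X) (hc : 0 < c) (hc1 : c ≤ 1)
    (hw : 0 < w) (hk : 0 < k) (hC : C ≤ 2 * N * k) :
    k / w * ((X + 2) * (k / w) + 2 * ((X + 2) * (k / w) / c) + (6 * k + 2 * C) / w +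
      2 * ((2 * X + 3) * (k / w))) ≤
    4 * N ^ 2 * (3 * X + 5) * k ^ 2 * (1 + 1 / w) ^ 2 / (c ^ 2 * w) := by
  have hR : 4 * N ^ 2 * (3 * X + 5) * k ^ 2 * (4 / w) / (c ^ 2 * w) ≤
      4 * N ^ 2 * (3 * X + 5) * k ^ 2 * (1 + 1 / w) ^ 2 / (c ^ 2 * w) := by
    gcongr
    exact four_div_le_one_add_one_div_sq hw
  refine le_trans ?_ hR
  have e : 4 * N ^ 2 * (3 * X + 5) * k ^ 2 * (4 / w) / (c ^ 2 * w) =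
      (k / w) ^ 2 * (16 * N ^ 2 * (3 * X + 5) / c ^ 2) := by field_simp; ring
  have e1 : (6 * k + 2 * C) / w ≤ (k / w) * (6 + 4 * N) := by
    rw [div_mul_eq_mul_div]
    gcongr
    linarith
  have hq : 0 < k / w := by positivity
  have h1 : 1 ≤ 1 / c := by rw [le_div_iff₀ hc]; linarith
  have h2 : 1 / c ≤ 1 / c ^ 2 := by
    apply one_div_le_one_div_of_le (by positivity)
    nlinarith
  rw [e]
  calc _ ≤ k / w * ((X + 2) * (k / w) + 2 * ((X + 2) * (k / w) / c) + (k / w) * (6 + 4 * N) +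
      2 * ((2 * X + 3) * (k / w))) := by gcongr
    _ = (k / w) ^ 2 * (5 * X + 14 + 4 * N + 2 * (X + 2) * (1 / c)) := by ring
    _ ≤ (k / w) ^ 2 * ((16 * N ^ 2 * (3 * X + 5)) * (1 / c ^ 2)) := by
      gcongr
      set D := 1 / c ^ 2
      have h3 : 1 ≤ D := h1.trans h2
      have h4 : 2 * (X + 2) * (1 / c) ≤ 2 * (X + 2) * D := by gcongr
      have h5 : 5 * X + 14 + 4 * N ≤ (5 * X + 14 + 4 * N) * D :=
        le_mul_of_one_le_right (by positivity) h3
      have h6 : 7 * X + 18 + 4 * N ≤ 16 * N ^ 2 * (3 * X + 5) := by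
        nlinarith [mul_nonneg hX (by nlinarith : 0 ≤ N ^ 2 - 1)]
      have h7 := mul_le_mul_of_nonneg_right h6 (by linarith : 0 ≤ D)
      linarith
    _ = _ := by ring

theorem statement_6
    (n : ℕ) (hn : 2 ≤ n) (α : ℝ) (hα0 : 0 < α) (hα1 : α ≤ 1)
    (Vl Vs : Euc n → ℝ) (βl0 βl1 βl2 βs1 βs2 βs3 : ℝ)
    (hβl0 : 0 < βl0) (hβl1 : 0 < βl1) (hβl2 : 0 < βl2)
    (hβs1 : 0 < βs1) (hβs2 : 0 < βs2) (hβs3 : 0 < βs3)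
    (hVl : LongRange α βl0 βl1 βl2 Vl) (hVs : ShortRange α βs1 βs2 βs3 Vs)
    (Fl Fs F : Euc n → Euc n)
    (hFl : ∀ y, Fl y = -gradient Vl y) (hFs : ∀ y, Fs y = -gradient Vs y)
    (hF : ∀ y, F y = Fl y + Fs y)
    (θ x : Euc n) (hθ : ‖θ‖ = 1) (hperp : ⟪θ, x⟫ = 0)
    (r : ℝ) (hr0 : 0 < r) (hr1 : r < 1)
    (s : ℝ) (hsμ : Real.sqrt (2 ^ 5 * (n : ℝ) * max βl1 βl2 / α) ≤ s) (hsr : 2 ^ ((3:ℝ)/2) * r < s)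
    (hcond : 4 * (max βl1 (max βl2 (max βs2 βs3))) * (n : ℝ) * (‖x‖ + 1) * (1 + 1 / (s / 2 ^ ((3:ℝ)/2) - r)) ^ 2 ≤
      α * r * (s / 2 ^ ((3:ℝ)/2) - r) * (1 - r) ^ (α + 2))
    (zm : ℝ → Euc n)
    (hzm : IsFreeSol Fl 0 (s • θ) atBot (2 ^ ((5:ℝ)/2) * Real.sqrt n * βl1 / (α * s)) zm)
    (ym : ℝ → Euc n) (hym : MemM r ym) (hfix : Aop Fl F zm x ym = ym)
    (a : Euc n) (ha : a = s • θ + ∫ τ : ℝ, F (zm τ + x + ym τ))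
    (zp : ℝ → Euc n) (hzp : IsFreeSol Fl 0 a atTop
      (2 ^ ((5:ℝ)/2) * Real.sqrt n * βl1 / (α * ‖a‖)) zp) :
    ‖lInt Fl Fs F zm x ym + l1Int Fl zp x + l2Int Fl zm zp x ym - Wvec Fl zm zp x -
        (∫ σ in Iic (0:ℝ), ∫ τ in Iic σ, Fs (τ • (s • θ) + x)) +
        ∫ σ in Ici (0:ℝ), ∫ τ in Ici σ, Fs (τ • (s • θ) + x)‖ ≤
      4 * (n : ℝ) ^ 2 * (3 * ‖x‖ + 5) * (max βl1 (max βl2 (max βs2 βs3))) ^ 2 * (1 + 1 / (s / 2 ^ ((3:ℝ)/2) - r)) ^ 2 /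
        (α ^ 2 * (1 - r) ^ (2 * α + 2) * (s / 2 ^ ((3:ℝ)/2) - r) ^ 3) := by
  have hN : (2 : ℝ) ≤ n := by exact_mod_cast hn
  set β := max βl1 (max βl2 (max βs2 βs3)) with hβdef
  set N : ℝ := (n : ℝ) with hNdef
  set q : ℝ := 2 ^ ((3 : ℝ) / 2) with hq
  set w := s / q - r with hw_def
  set c := 1 - r with hc_def
  have hq0 : 0 < q := by positivity
  have hq2 : q ^ 2 = 8 := by
    rw [hq, ← rpow_natCast, ← rpow_mul (by norm_num)]
    norm_num
  have hq' : (2 : ℝ) ^ ((5 : ℝ) / 2) = 2 * q := by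
    rw [hq, ← rpow_one_add' (by norm_num) (by norm_num)]
    norm_num
  have hq3 : 2 ≤ q := by nlinarith
  have b1 : βl1 ≤ β := le_max_left _ _
  have hβ : 0 < β := hβl1.trans_le b1
  have hc : 0 < c := by linarith
  have hc1 : c ≤ 1 := by linarith
  have hw : 0 < w := by
    have : r < s / q := by rw [lt_div_iff₀ hq0]; linarith
    linarith
  have hs : 0 < s := (by positivity : 0 < q * r).trans hsr
  have hwq : w + r = s / q := by ring
  have hsq : s / q ≤ s / 2 := by gcongr
  have hws : 2 * w ≤ s := by linarith
  set k := β * c ^ (-α) / (α * w) with hk_def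
  have hk : 0 < k := by positivity
  have hcα : 0 < c ^ α := rpow_pos_of_pos hc α
  have hk' : k = β / (α * w * c ^ α) := by
    rw [hk_def, rpow_neg hc.le]; field_simp
  have hsmall : k * (1 + 1 / w) ^ 2 ≤ c ^ 2 / 8 := by
    have e1 : c ^ (α + 2) = c ^ α * c ^ 2 := by
      rw [rpow_add hc]; norm_num
    rw [e1] at hcond
    have h1 : 8 * (β * (1 + 1 / w) ^ 2) ≤ 4 * β * N * (‖x‖ + 1) * (1 + 1 / w) ^ 2 := by
      have : 2 * 1 ≤ N * (‖x‖ + 1) :=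
        mul_le_mul hN (by linarith [norm_nonneg x]) (by norm_num) (by linarith)
      have := mul_le_mul_of_nonneg_left this (by positivity : 0 ≤ 4 * (β * (1 + 1 / w) ^ 2))
      linarith
    have h2 : α * r * w * (c ^ α * c ^ 2) ≤ α * w * c ^ α * c ^ 2 := by
      have := mul_le_mul_of_nonneg_right hr1.le (by positivity : 0 ≤ α * w * c ^ α * c ^ 2)
      linarith
    rw [hk', div_mul_eq_mul_div, div_le_iff₀ (by positivity)]
    linarith
  have hk32 : k ≤ w / 32 := by
    have h1 := mul_le_mul_of_nonneg_left (four_div_le_one_add_one_div_sq hw) hk.le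
    have h2 : c ^ 2 ≤ 1 := pow_le_one₀ hc.le hc1
    have h3 : k * (4 / w) ≤ 1 / 8 := by linarith
    rw [← mul_div_assoc, div_le_iff₀ hw] at h3
    linarith
  have hsN : √N ≤ N := (Real.sqrt_le_left (by linarith)).2 (by nlinarith)
  have hqN : q * √N ≤ 2 * N := by
    have h1 : √N ^ 2 = N := Real.sq_sqrt (by linarith)
    have h2 : q ≤ 2 * √N := by
      refine abs_le_of_sq_le_sq' ?_ (by positivity) |>.2
      rw [hq2, mul_pow, h1]
      linarith
    have h3 := mul_le_mul_of_nonneg_right h2 (Real.sqrt_nonneg N)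
    linarith
  have hs2 : 32 * N * βl1 ≤ α * s ^ 2 := by
    have h1 := (Real.sqrt_le_left hs.le).1 hsμ
    rw [div_le_iff₀ hα0] at h1
    have h2 : 32 * N * βl1 ≤ 2 ^ 5 * N * max βl1 βl2 := by
      norm_num
      gcongr
      exact le_max_left _ _
    linarith
  have hCnum : 2 * q * √N * βl1 ≤ α * (s ^ 2 / 8) := by
    have := mul_le_mul_of_nonneg_right hqN hβl1.le
    linarith
  rw [hq'] at hzm hzp
  have hC8 : 2 * q * √N * βl1 / (α * s) ≤ s / 8 := by
    rw [div_le_iff₀ (by positivity)]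
    linarith
  have hCk : 2 * q * √N * βl1 / (α * s) ≤ 2 * N * k := by
    have h1 : c ^ α ≤ 1 := rpow_le_one hc.le hc1 hα0.le
    have h2 : β / (α * w) ≤ k := by
      rw [hk']
      exact div_le_div_of_nonneg_left hβ.le (by positivity)
        (mul_le_of_le_one_right (by positivity) h1)
    have h3 : q * w ≤ s := by
      have h4 : q * (w + r) = s := by rw [hwq]; field_simp
      have h5 := mul_pos hq0 hr0
      linarith
    calc 2 * q * √N * βl1 / (α * s) ≤ 2 * q * N * β / (α * (q * w)) := by gcongr
      _ = 2 * N * (β / (α * w)) := by field_simp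
      _ ≤ _ := by gcongr
  have hFeq : F = fun y => Fl y + Fs y := funext hF
  have hI : Incoming α β c w r s (2 * q * √N * βl1 / (α * s)) k θ x Fl Fs zm ym :=
    { α_pos := hα0, β_pos := hβ, c_pos := hc, c_le := hc1, w_pos := hw, r_pos := hr0
      r_le := hr1.le, le_s := hws, k_eq := rfl, small := hsmall
      bounds := hVl.fieldBounds hα0 hVs hβl1 hFl hFs hθ hs.le hw hr1 (by linarith)
      norm_θ := hθ, perp := hperp, C_nonneg := by positivity, C_le := hC8, zm_sol := hzm
      ym_cont := hym.1, ym_nonpos := fun t => (hym.norm_le t).1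
      ym_nonneg := fun t => (hym.norm_le t).2
      ym_eq := fun t => by
        have := congrFun hfix t
        rw [Aop, hFeq] at this
        exact this.symm }
  rw [hFeq] at ha
  have hna : 15 / 16 * s ≤ ‖a‖ := by
    have h1 : ‖s • θ‖ - ‖a‖ ≤ ‖s • θ - a‖ := norm_sub_norm_le _ _
    have h2 : ‖s • θ - a‖ ≤ 4 * k := by
      rw [ha, norm_sub_rev, add_sub_cancel_left]
      exact hI.norm_integral_force_le
    rw [norm_smul, hθ, mul_one, Real.norm_of_nonneg hs.le] at h1
    linarith
  have hS : Scattering α β c w r s (2 * q * √N * βl1 / (α * s)) k θ x Fl Fs zm ym a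
      (2 * q * √N * βl1 / (α * ‖a‖)) zp :=
    { hI with
      a_eq := ha
      zp_sol := hzp
      C'_le := by
        have h1 : 2 * q * √N * βl1 / (α * ‖a‖) ≤ α * (s ^ 2 / 8) / (α * (15 / 16 * s)) := by
          gcongr
        have h2 : α * (s ^ 2 / 8) / (α * (15 / 16 * s)) = 2 / 15 * s := by
          field_simp; norm_num
        linarith }
  have hfin := hS.norm_remainder_le.trans
    (remainder_const_le hN (norm_nonneg x) hc hc1 hw hk hCk)
  have hrhs : 4 * N ^ 2 * (3 * ‖x‖ + 5) * k ^ 2 * (1 + 1 / w) ^ 2 / (c ^ 2 * w) =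
      4 * N ^ 2 * (3 * ‖x‖ + 5) * β ^ 2 * (1 + 1 / w) ^ 2 /
        (α ^ 2 * c ^ (2 * α + 2) * w ^ 3) := by
    have e1 : c ^ (2 * α + 2) = (c ^ α) ^ 2 * c ^ 2 := by
      rw [rpow_add hc, mul_comm 2 α, rpow_mul hc.le]; norm_num
    rw [e1, hk']
    field_simp
  rw [← hrhs]
  refine (le_of_eq ?_).trans hfin
  congr 1
  rw [lInt, l1Int, l2Int, Wvec, hFeq]
  abel

end Paper
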